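/- For every n ≥ 2, the group of affine permutations of F_3^n, consisting of all maps x ↦ A·x + v with A ∈ GL(n, F_3) and v ∈ F_3^n, is a maximal proper subgroup of the full symmetric group on F_3^n. -/

import Mathlib

/-- The group of affine permutations of `F₃ⁿ`: all maps `x ↦ A ⬝ x + v` with
`A ∈ GL(n, F₃)` and `v ∈ F₃ⁿ`, as a subgroup of the symmetric group on `F₃ⁿ`. -/
def affineSubgroup (n : ℕ) : Subgroup (Equiv.Perm (Fin n → ZMod 3)) where
  carrier := {π | ∃ (A : GL (Fin n) (ZMod 3)) (v : Fin n → ZMod 3),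
    ∀ x, π x = (A : Matrix (Fin n) (Fin n) (ZMod 3)).mulVec x + v}
  one_mem' := ⟨1, 0, fun x => by simp [Matrix.one_mulVec]⟩
  mul_mem' := by
    rintro p q ⟨A, v, hA⟩ ⟨B, w, hB⟩
    refine ⟨A * B, (A : Matrix (Fin n) (Fin n) (ZMod 3)).mulVec w + v, fun x => ?_⟩
    simp only [Equiv.Perm.mul_apply, hA, hB, Matrix.mulVec_add, Matrix.mulVec_mulVec,
      Units.val_mul, add_assoc]
  inv_mem' := by
    rintro p ⟨A, v, h⟩
    refine ⟨A⁻¹, -(((A⁻¹ : GL (Fin n) (ZMod 3)) : Matrix (Fin n) (Fin n) (ZMod 3)).mulVec v),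
      fun x => ?_⟩
    rw [Equiv.Perm.inv_def, Equiv.symm_apply_eq, h, Matrix.mulVec_add, Matrix.mulVec_neg,
      Matrix.mulVec_mulVec, Matrix.mulVec_mulVec, Units.mul_inv]
    simp [Matrix.one_mulVec]

set_option linter.unusedSectionVars false
open Equiv

section gen
variable {V : Type} [AddCommGroup V] [Module (ZMod 3) V]

theorem tri (x : V) : x + x + x = 0 := by
  have : ((3 : ZMod 3)) • x = 0 := by
    have : (3 : ZMod 3) = 0 := by decide
    rw [this, zero_smul]
  rw [← this]
  module

variable (V) in
/-- line preserving permutations -/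
def Aff : Subgroup (Perm V) where
  carrier := {f | ∀ x y z, x + y + z = 0 → f x + f y + f z = 0}
  one_mem' := fun x y z h => h
  mul_mem' := fun {f g} hf hg x y z h => hf _ _ _ (hg _ _ _ h)
  inv_mem' := by
    intro f hf a b c h
    have h1 := hf (f⁻¹ a) (f⁻¹ b) (-(f⁻¹ a) - f⁻¹ b) (by abel)
    simp only [show ∀ u, f (f⁻¹ u) = u from fun u => f.apply_symm_apply u] at h1
    have h2 : f (-(f⁻¹ a) - f⁻¹ b) = c := by
      rw [← sub_eq_zero]
      calc _ = (a + b + f (-(f⁻¹ a) - f⁻¹ b)) - (a + b + c) := by abel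
        _ = 0 := by rw [h1, h, sub_zero]
    rw [← h2]
    simp

theorem mem_Aff {f : Perm V} : f ∈ Aff V ↔ ∀ x y z, x + y + z = 0 → f x + f y + f z = 0 := Iff.rfl

theorem trans_mem (v : V) : Equiv.addRight v ∈ Aff V := by
  intro x y z h
  simp only [Equiv.coe_addRight]
  calc _ = (x + y + z) + (v + v + v) := by abel
    _ = 0 := by rw [h, tri, add_zero]

theorem lin_mem (e : V ≃ₗ[ZMod 3] V) : (e.toEquiv : Perm V) ∈ Aff V := by
  intro x y z h
  have := congrArg e h
  simpa using this

theorem exists_shear [Finite V] (φ : V →ₗ[ZMod 3] ZMod 3) (v : V) (hv : 1 + φ v ≠ 0) :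
    ∃ f ∈ Aff V, ∀ x, f x = x + φ x • v := by
  let L : V →ₗ[ZMod 3] V := LinearMap.id + φ.smulRight v
  have hL : ∀ x, L x = x + φ x • v := fun x => by simp [L]
  have hinj : Function.Injective L := by
    rw [injective_iff_map_eq_zero]
    intro x hx
    rw [hL] at hx
    have h1 := congrArg φ hx
    simp only [map_add, map_smul, smul_eq_mul, map_zero] at h1
    have h2 : φ x * (1 + φ v) = 0 := by linear_combination h1
    have h3 : φ x = 0 := (mul_eq_zero.1 h2).resolve_right hv
    simpa [h3] using hx
  exact ⟨(LinearEquiv.ofInjectiveEndo L hinj).toEquiv, lin_mem _, fun x => hL x⟩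

theorem exists_fix [Finite V] (W : Submodule (ZMod 3) V) {p q : V} (hp : p ∉ W) (hq : q ∉ W) :
    ∃ f ∈ Aff V, (∀ x ∈ W, f x = x) ∧ f p = q := by
  have : ∃ φ : V →ₗ[ZMod 3] ZMod 3, φ p ≠ 0 ∧ φ q ≠ 0 ∧ ∀ x ∈ W, φ x = 0 := by
    obtain ⟨f, hf, hfW⟩ := Submodule.exists_le_ker_of_notMem hp
    obtain ⟨g, hg, hgW⟩ := Submodule.exists_le_ker_of_notMem hq
    by_cases h1 : f q = 0
    · by_cases h2 : g p = 0
      · refine ⟨f + g, by simpa [h2], by simpa [h1], fun x hx => ?_⟩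
        have := hfW hx
        have := hgW hx
        simp_all
      · exact ⟨g, h2, hg, fun x hx => hgW hx⟩
    · exact ⟨f, hf, h1, fun x hx => hfW hx⟩
  obtain ⟨φ, h1, h2, h3⟩ := this
  obtain ⟨f, hf, hfx⟩ := exists_shear φ ((φ p)⁻¹ • (q - p)) (by
    simp only [map_smul, map_sub, smul_eq_mul]
    rw [mul_sub, inv_mul_cancel₀ h1]
    simp [h1, h2])
  refine ⟨f, hf, fun x hx => by simp [hfx, h3 x hx], ?_⟩
  rw [hfx, smul_smul, mul_inv_cancel₀ h1]
  simp

/-- affine version -/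
theorem exists_fix' [Finite V] (W : Submodule (ZMod 3) V) (c : V) {p q : V} (hp : p - c ∉ W)
    (hq : q - c ∉ W) :
    ∃ f ∈ Aff V, (∀ x, x - c ∈ W → f x = x) ∧ f p = q := by
  obtain ⟨f, hf, h1, h2⟩ := exists_fix W hp hq
  refine ⟨Equiv.addRight c * f * (Equiv.addRight c)⁻¹,
    mul_mem (mul_mem (trans_mem c) hf) (inv_mem (trans_mem c)), fun x hx => ?_, ?_⟩
  · have := h1 _ hx
    simp [← sub_eq_add_neg, this]
  · simp [← sub_eq_add_neg, h2]

theorem two_trans [Finite V] {x y x' y' : V} (h : x ≠ y) (h' : x' ≠ y') :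
    ∃ f ∈ Aff V, f x = x' ∧ f y = y' := by
  obtain ⟨f, hf, h1, h2⟩ := exists_fix' (⊥ : Submodule (ZMod 3) V) x' (p := y + (x' - x)) (q := y')
    (by simp only [Submodule.mem_bot]; intro h0; apply h; 
        rw [← sub_eq_zero, ← neg_eq_zero, ← h0]; abel)
    (by simp only [Submodule.mem_bot]; intro h0; exact h' (sub_eq_zero.1 h0).symm)
  refine ⟨f * Equiv.addRight (x' - x), mul_mem hf (trans_mem _), ?_, ?_⟩
  · simp only [Perm.mul_apply, Equiv.coe_addRight]
    rw [add_sub_cancel]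
    exact h1 _ (by simp)
  · simpa using h2

theorem mem_line {x y p : V} : p - x ∈ Submodule.span (ZMod 3) {y - x} ↔
    p = x ∨ p = y ∨ x + y + p = 0 := by
  rw [Submodule.mem_span_singleton]
  constructor
  · rintro ⟨a, ha⟩
    have : a = 0 ∨ a = 1 ∨ a = -1 := by clear ha; revert a; decide
    rcases this with rfl | rfl | rfl
    · left; rw [zero_smul] at ha; exact (sub_eq_zero.1 ha.symm)
    · right; left; rw [one_smul] at ha; exact (sub_left_injective ha).symm
    · right; right
      rw [neg_smul, one_smul] at ha
      have : p = x - (y - x) := by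
        rw [← sub_add_cancel p x, ← ha]; abel
      rw [this, ← tri x]; abel
  · rintro (rfl | rfl | h)
    · exact ⟨0, by simp⟩
    · exact ⟨1, by simp⟩
    · refine ⟨-1, ?_⟩
      rw [neg_smul, one_smul, eq_comm, ← sub_eq_zero]
      have h3 := tri x
      calc p - x - -(y - x) = (x + y + p) - (x + x + x) := by abel
        _ = 0 := by rw [h, h3, sub_zero]

theorem exists_fix_line [Finite V] {x y p q : V} (hp : p ≠ x ∧ p ≠ y ∧ x + y + p ≠ 0)
    (hq : q ≠ x ∧ q ≠ y ∧ x + y + q ≠ 0) :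
    ∃ f ∈ Aff V, f x = x ∧ f y = y ∧ (∀ z, x + y + z = 0 → f z = z) ∧ f p = q := by
  obtain ⟨f, hf, h1, h2⟩ := exists_fix' (Submodule.span (ZMod 3) {y - x}) x (p := p) (q := q)
    (by rw [mem_line]; tauto) (by rw [mem_line]; tauto)
  exact ⟨f, hf, h1 _ (mem_line.2 (by simp)), h1 _ (mem_line.2 (by simp)),
    fun z hz => h1 _ (mem_line.2 (by tauto)), h2⟩

theorem line_ne {x y z : V} (h : x + y + z = 0) (hxy : x ≠ y) : x ≠ z ∧ y ≠ z := by
  constructor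
  · rintro rfl
    apply hxy
    have := tri x
    rw [← sub_eq_zero]
    calc x - y = (x + x + x) - (x + y + x) := by abel
      _ = 0 := by rw [h, this, sub_zero]
  · rintro rfl
    apply hxy
    have := tri y
    rw [← sub_eq_zero]
    calc x - y = (x + y + y) - (y + y + y) := by abel
      _ = 0 := by rw [h, this, sub_zero]

theorem exists_bad {g : Perm V} (hg : g ∉ Aff V) :
    ∃ x y z, x + y + z = 0 ∧ x ≠ y ∧ g x + g y + g z ≠ 0 := by
  rw [mem_Aff] at hg
  push Not at hg
  obtain ⟨x, y, z, h, h'⟩ := hg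
  refine ⟨x, y, z, h, ?_, h'⟩
  rintro rfl
  have : z = x := by
    rw [← sub_eq_zero]
    calc z - x = (x + x + z) - (x + x + x) := by abel
      _ = 0 := by rw [h, tri, sub_zero]
  subst this
  exact h' (tri _)

theorem prim [Finite V] {G : Subgroup (Perm V)} (hG : Aff V ≤ G) :
    MulAction.IsPreprimitive G V := by
  apply MulAction.isPreprimitive_of_is_two_pretransitive
  rw [MulAction.is_two_pretransitive_iff]
  intro a b c d hab hcd
  obtain ⟨f, hf, h1, h2⟩ := two_trans hab hcd
  exact ⟨⟨f, hG hf⟩, h1, h2⟩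

theorem exists_odd [Fintype V] [DecidableEq V] [Nontrivial V] : ∃ f ∈ Aff V, Perm.sign f = -1 := by
  obtain ⟨v, hv⟩ := exists_ne (0 : V)
  obtain ⟨φ, h, -⟩ := Submodule.exists_le_ker_of_notMem (K := ZMod 3) (p := (⊥ : Submodule (ZMod 3) V)) (v := v) (by simpa)
  obtain ⟨w, hw⟩ : ∃ w, φ w = 1 := ⟨(φ v)⁻¹ • v, by simp [h]⟩
  let E : (LinearMap.ker φ × ZMod 3) ≃ V :=
    { toFun := fun p => p.1 + p.2 • w
      invFun := fun x => (⟨x - φ x • w, by simp [hw]⟩, φ x)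
      left_inv := by
        rintro ⟨⟨x, hx⟩, t⟩
        have : φ x = 0 := hx
        simp [hw, this]
      right_inv := fun x => by simp }
  have : Fintype (LinearMap.ker φ) := Fintype.ofFinite _
  let ν : Perm (ZMod 3) := Equiv.neg _
  refine ⟨E.permCongr (Equiv.prodCongrRight fun _ => ν), ?_, ?_⟩
  · have : ∀ x, E.permCongr (Equiv.prodCongrRight fun _ => ν) x = x + φ x • w := by
      intro x
      simp only [Equiv.permCongr_apply]
      simp [E, ν]
      have := tri (φ x • w)
      rw [← sub_eq_zero, ← neg_eq_zero, ← this]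
      abel
    intro x y z hxyz
    simp only [this]
    have h1 := congrArg φ hxyz
    simp only [map_add, map_zero] at h1
    calc _ = (x + y + z) + (φ x + φ y + φ z) • w := by module
      _ = 0 := by rw [h1, hxyz]; simp
  · rw [Perm.sign_permCongr, Perm.sign_prodCongrRight]
    have hν : Perm.sign ν = -1 := by decide
    rw [hν, Finset.prod_const, Finset.card_univ]
    have : Fintype.card (LinearMap.ker φ) = 3 ^ Module.finrank (ZMod 3) (LinearMap.ker φ) := by
      rw [Module.card_eq_pow_finrank (K := ZMod 3)]
      simp
    rw [this]
    exact Odd.neg_one_pow (Odd.pow (by decide))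

theorem finish [Fintype V] [DecidableEq V] [Nontrivial V] {G : Subgroup (Perm V)} (hG : Aff V ≤ G)
    {g : Perm V} (hg : g ∈ G) (h3 : g.IsThreeCycle) : G = ⊤ := by
  have h := Perm.alternatingGroup_le_of_isPreprimitive_of_isThreeCycle_mem (prim hG) h3 hg
  obtain ⟨f, hf, hs⟩ := exists_odd (V := V)
  rw [eq_top_iff]
  intro p _
  rcases Int.units_eq_one_or (Perm.sign p) with h1 | h1
  · exact h (Perm.mem_alternatingGroup.2 h1)
  · have : p * f ∈ G := h (Perm.mem_alternatingGroup.2 (by rw [Perm.sign_mul, h1, hs]; rfl))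
    simpa using mul_mem this (inv_mem (hG hf))

end gen

section base

def enc (x : ZMod 3 × ZMod 3) : ℕ := 3 * x.1.val + x.2.val

def dec9 (k : ℕ) : ZMod 3 × ZMod 3 := (((k / 3 : ℕ) : ZMod 3), ((k % 3 : ℕ) : ZMod 3))

/-- entry `i` of a table of base-16 digits -/
def look (l i : ℕ) : ℕ := Nat.mod (Nat.div l (Nat.pow 16 i)) 16

/-- the table of a list of digits -/
def tab : List ℕ → ℕ
  | [] => 0
  | a :: l => Nat.add a (Nat.mul 16 (tab l))

theorem look_tab (l : List ℕ) (hl : ∀ x ∈ l, x < 16) (i : ℕ) : look (tab l) i = l.getD i 0 := by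
  induction l generalizing i with
  | nil =>
    change 0 / 16 ^ i % 16 = _
    simp
  | cons a l ih =>
    have ha : a < 16 := hl a (by simp)
    have h' := ih (fun x hx => hl x (by simp [hx]))
    change (a + 16 * tab l) / 16 ^ i % 16 = _
    cases i with
    | zero => simp; omega
    | succ i =>
      rw [pow_succ', ← Nat.div_div_eq_div_mul, List.getD_cons_succ, ← h']
      have : (a + 16 * tab l) / 16 = tab l := by omega
      rw [this]
      rfl

/-- fourteen affine permutations of the plane, as tables (image of `i` is the `i`-th base-16 digit from
the right) -/
def alphas : List ℕ :=
  [31161780306, 19079234946, 27787604481, 14050419201, 2221216551, 1463293476, 35189491266,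
   23106945906, 21596627736, 27137410866, 15054865506, 17317393686, 12990972951, 14803145856]

def fourth (l a i : ℕ) : ℕ :=
  look l (look a (look l (look a (look l (look a (look l (look a i)))))))

def check1 (l a : ℕ) : Bool :=
  Nat.beq ((List.range 9).filter (fun i => Nat.beq (fourth l a i) i)).length 6

def check (l : List ℕ) : Bool := alphas.any (check1 (tab l))

def go : ℕ → List ℕ → Bool
  | 0, acc => check acc
  | k + 1, acc => (List.range 9).all (fun a => acc.elem a || go k (acc ++ [a]))

theorem go_true : go 6 [0, 1, 3] = true := by decide +kernel

theorem go_sound (k : ℕ) (acc : List ℕ) (h : go k acc = true) (rest : List ℕ)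
    (hr : rest.length = k) (hnd : (acc ++ rest).Nodup) (hlt : ∀ i ∈ rest, i < 9) :
    check (acc ++ rest) = true := by
  induction k generalizing acc rest with
  | zero =>
    rw [List.length_eq_zero_iff] at hr
    subst hr
    simpa [go] using h
  | succ k ih =>
    obtain ⟨a, rest, rfl⟩ := List.exists_cons_of_length_eq_add_one hr
    simp only [go, List.all_eq_true, List.mem_range, Bool.or_eq_true, List.elem_eq_mem,
      decide_eq_true_eq] at h
    have hna : a ∉ acc := by
      intro ha
      rw [List.nodup_append] at hnd
      exact hnd.2.2 a ha a (by simp) rfl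
    have h1 := (h a (hlt a (by simp))).resolve_left hna
    have := ih (acc ++ [a]) h1 rest (by simpa using hr) (by simpa using hnd)
      (fun i hi => hlt i (by simp [hi]))
    simpa using this

theorem enc_inj : Function.Injective enc := by
  unfold Function.Injective
  decide +kernel

theorem enc_lt (x) : enc x < 9 := by revert x; decide +kernel

theorem enc_dec (k : ℕ) (hk : k < 9) : enc (dec9 k) = k := by
  revert k; decide +kernel

theorem dec_enc (x) : dec9 (enc x) = x := enc_inj (enc_dec _ (enc_lt x))

def TabRep (l : ℕ) (f : Perm (ZMod 3 × ZMod 3)) : Prop :=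
  ∀ x, look l (enc x) = enc (f x)

theorem alphas_inj : ∀ a ∈ alphas, (∀ i < 9, look a i < 9) ∧
   (∀ x y, dec9 (look a (enc x)) = dec9 (look a (enc y)) → x = y) ∧
   (∀ x y, dec9 (look a (enc x)) + dec9 (look a (enc y)) + dec9 (look a (enc (- x - y))) = 0) := by
  decide +kernel

theorem alphas_aff (a : ℕ) (ha : a ∈ alphas) :
    ∃ f ∈ Aff (ZMod 3 × ZMod 3), TabRep a f := by
  obtain ⟨h2, h3, h4⟩ := alphas_inj a ha
  refine ⟨Equiv.ofBijective (fun x => dec9 (look a (enc x)))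
    (Finite.injective_iff_bijective.1 fun x y => h3 x y), ?_, ?_⟩
  · intro x y z h
    have : z = - x - y := by
      rw [← sub_eq_zero, ← h]; abel
    subst this
    exact h4 x y
  · intro x
    simp only [Equiv.ofBijective_apply]
    rw [enc_dec _ (h2 _ (enc_lt x))]

theorem base_comp {g : Perm (ZMod 3 × ZMod 3)} (h0 : g (0, 0) = (0, 0)) (h1 : g (0, 1) = (0, 1))
    (h2 : g (0, 2) = (1, 0)) : ∃ f ∈ Aff (ZMod 3 × ZMod 3), ((g * f) ^ 4).IsThreeCycle := by
  let l : List ℕ := (List.range 9).map fun i => enc (g (dec9 i))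
  have hl : TabRep (tab l) g := by
    intro x
    have hlt : ∀ x ∈ l, x < 16 := by
      intro i hi
      simp only [l, List.mem_map] at hi
      obtain ⟨j, -, rfl⟩ := hi
      exact (enc_lt _).trans (by norm_num)
    have := enc_lt x
    rw [look_tab l hlt]
    simp [l, List.getD_eq_getElem?_getD, this, dec_enc]
  let rest : List ℕ := ((List.range 6).map (· + 3)).map fun i => enc (g (dec9 i))
  have hrest : l = [0, 1, 3] ++ rest := by
    have e0 : enc (g (dec9 0)) = 0 := by
      rw [show dec9 0 = (0, 0) by decide, h0]; rfl
    have e1 : enc (g (dec9 1)) = 1 := by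
      rw [show dec9 1 = (0, 1) by decide, h1]; rfl
    have e2 : enc (g (dec9 2)) = 3 := by
      rw [show dec9 2 = (0, 2) by decide, h2]; rfl
    have hr : List.range 9 = [0, 1, 2] ++ (List.range 6).map (· + 3) := by decide
    simp only [l, rest, hr, List.map_append, List.map_cons, List.map_nil, e0, e1, e2]
  have hnd : l.Nodup := by
    refine List.Nodup.map_on ?_ List.nodup_range
    intro i hi j hj hij
    have h := g.injective (enc_inj hij)
    rw [← enc_dec i (List.mem_range.1 hi), h, enc_dec j (List.mem_range.1 hj)]
  have hc : check l = true := by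
    rw [hrest] at hnd ⊢
    refine go_sound 6 _ go_true rest (by simp [rest]) hnd ?_
    intro i hi
    simp only [rest, List.mem_map] at hi
    obtain ⟨j, -, rfl⟩ := hi
    exact enc_lt _
  obtain ⟨a, ha, hca⟩ := List.any_eq_true.1 hc
  obtain ⟨f, hf, hfa⟩ := alphas_aff a ha
  refine ⟨f, hf, ?_⟩
  have hr : ∀ x, fourth (tab l) a (enc x) = enc (((g * f) ^ 4) x) := by
    intro x
    have e : (g * f) ^ 4 = g * f * (g * f) * (g * f) * (g * f) := by
      simp only [pow_succ, pow_zero, one_mul]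
    rw [e]
    simp only [fourth, hl _, hfa _, Perm.mul_apply]
  rw [← card_support_eq_three_iff]
  set q := (g * f) ^ 4
  have hfil : ((Finset.range 9).filter (fun i => fourth (tab l) a i = i)).card = 6 := by
    have := hca
    simp only [check1] at this
    replace this := Nat.eq_of_beq_eq_true this
    rw [← this]
    change (List.filter _ (List.range 9)).length = _
    congr 2
    ext i
    rw [Bool.eq_iff_iff, decide_eq_true_iff]
    exact ⟨fun h => by rw [h]; exact Nat.beq_refl i, Nat.eq_of_beq_eq_true⟩
  have himg : (Finset.range 9).filter (fun i => fourth (tab l) a i = i)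
      = (Finset.univ.filter (fun x => q x = x)).image enc := by
    ext i
    simp only [Finset.mem_filter, Finset.mem_range, Finset.mem_image, Finset.mem_univ, true_and]
    constructor
    · rintro ⟨hi, h⟩
      refine ⟨dec9 i, ?_, enc_dec i hi⟩
      apply enc_inj
      rw [← hr, enc_dec i hi, h]
    · rintro ⟨x, hx, rfl⟩
      exact ⟨enc_lt x, by rw [hr, hx]⟩
  rw [himg, Finset.card_image_of_injective _ enc_inj] at hfil
  have hs := Finset.card_filter_add_card_filter_not (s := (Finset.univ : Finset (ZMod 3 × ZMod 3)))
    (fun x => q x = x)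
  have hcard : (Finset.univ : Finset (ZMod 3 × ZMod 3)).card = 9 := by decide
  have : q.support = Finset.univ.filter (fun x => ¬ q x = x) := by
    ext x; simp [Perm.mem_support]
  rw [this]
  omega

theorem three_trans {V : Type} [AddCommGroup V] [Module (ZMod 3) V] [Finite V] {x y z x' y' z' : V}
    (hxy : x ≠ y) (hz : x + y + z ≠ 0) (hxz : x ≠ z) (hyz : y ≠ z)
    (hxy' : x' ≠ y') (hz' : x' + y' + z' ≠ 0) (hxz' : x' ≠ z') (hyz' : y' ≠ z') :
    ∃ f ∈ Aff V, f x = x' ∧ f y = y' ∧ f z = z' := by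
  obtain ⟨f, hf, h1, h2⟩ := two_trans hxy hxy'
  have hfz : x' + y' + f z ≠ 0 := by
    intro h
    rw [← h1, ← h2] at h
    have := inv_mem hf _ _ _ h
    simp at this
    exact hz this
  obtain ⟨k, hk, k1, k2, -, k3⟩ := exists_fix_line (x := x') (y := y') (p := f z) (q := z')
    ⟨fun h => hxz (f.injective (h1.trans h.symm)), fun h => hyz (f.injective (h2.trans h.symm)), hfz⟩
    ⟨hxz'.symm, hyz'.symm, hz'⟩
  exact ⟨k * f, mul_mem hk hf, by simp [h1, k1], by simp [h2, k2], by simp [k3]⟩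

theorem base_prod {G : Subgroup (Perm (ZMod 3 × ZMod 3))} (hG : Aff _ ≤ G)
    {g : Perm (ZMod 3 × ZMod 3)} (hg : g ∈ G) (hgA : g ∉ Aff (ZMod 3 × ZMod 3)) : G = ⊤ := by
  obtain ⟨x, y, z, hs, hxy, hgs⟩ := exists_bad hgA
  obtain ⟨a, ha, a1, a2⟩ := two_trans (x := ((0 : ZMod 3), (0 : ZMod 3))) (y := (0, 1)) (by decide) hxy
  have a3 : a (0, 2) = z := by
    have := ha (0, 0) (0, 1) (0, 2) (by decide)
    rw [a1, a2, ← hs] at this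
    exact add_left_cancel this
  obtain ⟨hxz, hyz⟩ := line_ne hs hxy
  obtain ⟨b, hb, b1, b2, b3⟩ := three_trans (g.injective.ne hxy) hgs (g.injective.ne hxz)
    (g.injective.ne hyz) (x' := ((0 : ZMod 3), (0 : ZMod 3))) (y' := (0, 1)) (z' := (1, 0))
    (by decide) (by decide) (by decide) (by decide)
  obtain ⟨f, hf, h3⟩ := base_comp (g := b * g * a) (by simp [a1, b1]) (by simp [a2, b2])
    (by simp [a3, b3])
  exact finish hG (pow_mem (mul_mem (mul_mem (mul_mem (hG hb) hg) (hG ha)) (hG hf)) 4) h3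

theorem base_gen {V : Type} [AddCommGroup V] [Module (ZMod 3) V] [Finite V]
    (h2 : Module.finrank (ZMod 3) V = 2) {G : Subgroup (Perm V)} (hG : Aff V ≤ G)
    {g : Perm V} (hg : g ∈ G) (hgA : g ∉ Aff V) : G = ⊤ := by
  obtain ⟨e⟩ : Nonempty (V ≃ₗ[ZMod 3] (ZMod 3 × ZMod 3)) :=
    FiniteDimensional.nonempty_linearEquiv_of_finrank_eq (by simp [h2])
  let E : Perm V ≃* Perm (ZMod 3 × ZMod 3) := e.toEquiv.permCongrHom
  have hE : ∀ p x, E p (e x) = e (p x) := fun p x => by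
    simp [E, Equiv.permCongrHom]
  have hA : ∀ p, E p ∈ Aff _ ↔ p ∈ Aff V := by
    intro p
    constructor
    · intro h x y z hs
      have := h (e x) (e y) (e z) (by simp [← map_add, hs])
      rw [hE, hE, hE, ← map_add, ← map_add] at this
      exact (map_eq_zero_iff e e.injective).1 this
    · intro h x y z hs
      obtain ⟨x, rfl⟩ := e.surjective x
      obtain ⟨y, rfl⟩ := e.surjective y
      obtain ⟨z, rfl⟩ := e.surjective z
      rw [← map_add, ← map_add] at hs
      have := h x y z ((map_eq_zero_iff e e.injective).1 hs)
      rw [hE, hE, hE, ← map_add, ← map_add, this, map_zero]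
  have key : G.map E.toMonoidHom = ⊤ := by
    refine base_prod (g := E g) ?_ ⟨g, hg, rfl⟩ (by rwa [hA])
    intro p hp
    obtain ⟨p, rfl⟩ := E.surjective p
    exact ⟨p, hG ((hA p).1 hp), rfl⟩
  rw [eq_top_iff]
  intro p _
  have : E p ∈ G.map E.toMonoidHom := by rw [key]; trivial
  obtain ⟨q, hq, h⟩ := this
  have := E.injective h
  rwa [← this]

end base

section jordan
variable {V : Type} [AddCommGroup V] [Module (ZMod 3) V] [Finite V]

/-- the pointwise stabilizer of `S` in `G` is transitive off `S` -/
def Jor (G : Subgroup (Perm V)) (S : Set V) : Prop :=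
  ∀ p q, p ∉ S → q ∉ S → ∃ g ∈ G, (∀ s ∈ S, g s = s) ∧ g p = q

theorem Jor.inter {G : Subgroup (Perm V)} {S T : Set V} (hS : Jor G S) (hT : Jor G T)
    (hc : S.ncard + T.ncard < Nat.card V) : Jor G (S ∩ T) := by
  obtain ⟨r, hr⟩ : ∃ r, r ∉ S ∪ T := by
    by_contra! h
    have h1 : S ∪ T = Set.univ := Set.eq_univ_of_forall h
    have h2 := Set.ncard_union_le S T
    rw [h1, Set.ncard_univ] at h2
    omega
  have key : ∀ p, p ∉ S ∩ T → ∃ g ∈ G, (∀ s ∈ S ∩ T, g s = s) ∧ g p = r := by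
    intro p hp
    by_cases h : p ∈ S
    · obtain ⟨g, hg, h1, h2⟩ := hT p r (fun h' => hp ⟨h, h'⟩) (fun h' => hr (Or.inr h'))
      exact ⟨g, hg, fun s hs => h1 s hs.2, h2⟩
    · obtain ⟨g, hg, h1, h2⟩ := hS p r h (fun h' => hr (Or.inl h'))
      exact ⟨g, hg, fun s hs => h1 s hs.1, h2⟩
  intro p q hp hq
  obtain ⟨g, hg, g1, g2⟩ := key p hp
  obtain ⟨k, hk, k1, k2⟩ := key q hq
  refine ⟨k⁻¹ * g, mul_mem (inv_mem hk) hg, fun s hs => ?_, ?_⟩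
  · rw [Perm.mul_apply, g1 s hs, Perm.inv_eq_iff_eq, k1 s hs]
  · rw [Perm.mul_apply, g2, Perm.inv_eq_iff_eq, k2]

theorem Jor.image {G : Subgroup (Perm V)} {S : Set V} (hS : Jor G S) {g : Perm V} (hg : g ∈ G) :
    Jor G (g '' S) := by
  intro p q hp hq
  obtain ⟨p, rfl⟩ := g.surjective p
  obtain ⟨q, rfl⟩ := g.surjective q
  obtain ⟨k, hk, h1, h2⟩ := hS p q (fun h => hp ⟨p, h, rfl⟩) (fun h => hq ⟨q, h, rfl⟩)
  refine ⟨g * k * g⁻¹, mul_mem (mul_mem hg hk) (inv_mem hg), ?_, by simp [h2]⟩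
  rintro _ ⟨s, hs, rfl⟩
  simp [h1 s hs]

theorem jor_line {G : Subgroup (Perm V)} (hG : Aff V ≤ G) {x y z : V} (h : x + y + z = 0) :
    Jor G {x, y, z} := by
  have key : ∀ p, p ∉ ({x, y, z} : Set V) → p ≠ x ∧ p ≠ y ∧ x + y + p ≠ 0 := by
    intro p hp
    simp only [Set.mem_insert_iff, Set.mem_singleton_iff, not_or] at hp
    refine ⟨hp.1, hp.2.1, fun h' => hp.2.2 ?_⟩
    rw [← h] at h'
    exact add_left_cancel h'
  intro p q hp hq
  obtain ⟨f, hf, h1, h2, h3, h4⟩ := exists_fix_line (key p hp) (key q hq)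
  refine ⟨f, hG hf, ?_, h4⟩
  rintro s (rfl | rfl | rfl)
  · exact h1
  · exact h2
  · exact h3 _ h

theorem jor_pair {G : Subgroup (Perm V)} (hG : Aff V ≤ G) {g : Perm V} (hg : g ∈ G)
    (hgA : g ∉ Aff V) (hV : 9 ≤ Nat.card V) {a b : V} (hab : a ≠ b) : Jor G {a, b} := by
  obtain ⟨x, y, z, hs, hxy, hgs⟩ := exists_bad hgA
  obtain ⟨hxz, hyz⟩ := line_ne hs hxy
  have three : ∀ a b c : V, ({a, b, c} : Set V).ncard ≤ 3 := fun a b c => by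
    have h1 := Set.ncard_insert_le a {b, c}
    have h2 := Set.ncard_insert_le b {c}
    rw [Set.ncard_singleton] at h2
    omega
  have h1 : Jor G (g '' {x, y, z}) := (jor_line hG hs).image hg
  have h2 : Jor G {g x, g y, - g x - g y} := jor_line hG (by abel)
  have h3 := h1.inter h2 (by
    have := three (g x) (g y) (- g x - g y)
    have h := three x y z
    have := Set.ncard_image_le (f := g) (Set.toFinite {x, y, z})
    omega)
  have h4 : g '' {x, y, z} ∩ {g x, g y, - g x - g y} = {g x, g y} := by
    ext u
    simp only [Set.mem_inter_iff, Set.mem_image, Set.mem_insert_iff, Set.mem_singleton_iff]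
    constructor
    · rintro ⟨⟨v, (rfl | rfl | rfl), rfl⟩, h⟩
      · simp
      · simp
      · rcases h with h | h | h
        · exact absurd h (g.injective.ne hxz.symm)
        · exact absurd h (g.injective.ne hyz.symm)
        · exfalso; apply hgs; rw [h]; abel
    · rintro (rfl | rfl)
      · exact ⟨⟨x, by simp, rfl⟩, by simp⟩
      · exact ⟨⟨y, by simp, rfl⟩, by simp⟩
  rw [h4] at h3
  obtain ⟨f, hf, f1, f2⟩ := two_trans (g.injective.ne hxy) hab
  have := h3.image (hG hf)
  rwa [Set.image_pair, f1, f2] at this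

/-- splitting along a functional -/
def splitE (φ : V →ₗ[ZMod 3] ZMod 3) (w : V) (hw : φ w = 1) : (LinearMap.ker φ × ZMod 3) ≃ V where
  toFun := fun p => p.1 + p.2 • w
  invFun := fun x => (⟨x - φ x • w, by simp [hw]⟩, φ x)
  left_inv := by
    rintro ⟨⟨x, hx⟩, t⟩
    have : φ x = 0 := hx
    simp [hw, this]
  right_inv := fun x => by simp

theorem card_ker (φ : V →ₗ[ZMod 3] ZMod 3) (w : V) (hw : φ w = 1) :
    Nat.card V = 3 * Nat.card (LinearMap.ker φ) := by
  rw [← Nat.card_congr (splitE φ w hw), Nat.card_prod, Nat.card_zmod, mul_comm]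

theorem exists_stab {G : Subgroup (Perm V)} (hG : Aff V ≤ G) {g : Perm V} (hg : g ∈ G)
    (hgA : g ∉ Aff V) (φ : V →ₗ[ZMod 3] ZMod 3) (w : V) (hw : φ w = 1)
    (hK : 9 ≤ Nat.card (LinearMap.ker φ)) :
    ∃ g ∈ G, (∀ x, φ x = 0 → φ (g x) = 0) ∧
      ∃ x y z, φ x = 0 ∧ φ y = 0 ∧ φ z = 0 ∧ x + y + z = 0 ∧ g x + g y + g z ≠ 0 := by
  have hV := card_ker φ w hw
  let H : Set V := {x | φ x = 0}
  have hHc : H.ncard = Nat.card (LinearMap.ker φ) := rfl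
  have hJH : Jor G H := by
    intro p q hp hq
    obtain ⟨f, hf, h1, h2⟩ := exists_fix (LinearMap.ker φ) (p := p) (q := q) hp hq
    exact ⟨f, hG hf, h1, h2⟩
  have hsub : ∀ S : Set V, S ⊆ H → S.ncard ≤ H.ncard := fun S hS =>
    Set.ncard_le_ncard hS (Set.toFinite _)
  have hcap : ∀ S T : Set V, Jor G S → Jor G T → S.ncard ≤ H.ncard → T.ncard ≤ H.ncard →
      Jor G (S ∩ T) := fun S T hS hT h1 h2 => hS.inter hT (by omega)
  -- a line in H
  obtain ⟨y0, hy0', hy00⟩ : ∃ y, φ y = 0 ∧ y ≠ 0 := by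
    by_contra! h
    have : Subsingleton (LinearMap.ker φ) := ⟨fun a b => by
      apply Subtype.ext; rw [h a.1 a.2, h b.1 b.2]⟩
    have := Finite.card_le_one_iff_subsingleton.2 this
    omega
  obtain ⟨x, y, z, hxH, hy, hzH, hsum, hy0⟩ : ∃ x y z : V, φ x = 0 ∧ φ y = 0 ∧ φ z = 0 ∧
      x + y + z = 0 ∧ y ≠ x := ⟨0, y0, -y0, by simp, hy0', by simp [hy0'], by simp, hy00⟩
  obtain ⟨hxz, hyz⟩ := line_ne hsum hy0.symm
  -- maximal D
  let PD : Set (Set V) := {D | Jor G D ∧ D ⊆ H ∧ x ∈ D ∧ y ∈ D ∧ z ∉ D}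
  obtain ⟨D, ⟨hDJ, hDH, hxD, hyD, hzD⟩, hDmax⟩ := Set.exists_max_image PD Set.ncard (Set.toFinite _)
    ⟨{x, y}, jor_pair hG hg hgA (by omega) hy0.symm, by
      rintro u (rfl | rfl)
      · exact hxH
      · exact hy, by simp, by simp, by simp [hxz.symm, hyz.symm]⟩
  let PC : Set (Set V) := {C | Jor G C ∧ C ⊆ H ∧ D ⊆ C ∧ z ∈ C}
  obtain ⟨C, ⟨hCJ, hCH, hDC, hzC⟩, hCmin⟩ := Set.exists_min_image PC Set.ncard (Set.toFinite _)
    ⟨H, hJH, subset_rfl, hDH, hzH⟩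
  have key : ∀ p ∈ H, p ∉ D → ∀ g ∈ G, (∀ s ∈ D, g s = s) → g z = p → g '' C = C := by
    intro p hpH hpD g hg hgD hgz
    have hgc : (g '' C).ncard = C.ncard := Set.ncard_image_of_injective _ g.injective
    have hDg : D ⊆ g '' C := fun s hs => ⟨s, hDC hs, hgD s hs⟩
    have hBJ : Jor G (g '' C ∩ H) := hcap _ _ (hCJ.image hg) hJH (by rw [hgc]; exact hsub _ hCH)
      le_rfl
    have hzB : z ∈ g '' C ∩ H := by
      by_contra hzB
      have h1 := hDmax (g '' C ∩ H) ⟨hBJ, Set.inter_subset_right, ⟨hDg hxD, hxH⟩, ⟨hDg hyD, hy⟩, hzB⟩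
      have h2 : D ⊂ g '' C ∩ H := by
        refine ⟨fun s hs => ⟨hDg hs, hDH hs⟩, fun h => hpD (h ⟨⟨z, hzC, hgz⟩, hpH⟩)⟩
      have h3 := Set.ncard_lt_ncard h2 (Set.toFinite _)
      omega
    have hJ2 : Jor G (g '' C ∩ C) := hcap _ _ (hCJ.image hg) hCJ (by rw [hgc]; exact hsub _ hCH)
      (hsub _ hCH)
    have h1 := hCmin (g '' C ∩ C) ⟨hJ2, fun s hs => hCH hs.2, fun s hs => ⟨hDg hs, hDC hs⟩,
      ⟨hzB.1, hzC⟩⟩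
    have h2 : g '' C ∩ C = C := Set.eq_of_subset_of_ncard_le Set.inter_subset_right h1 (Set.toFinite _)
    have h3 : C ⊆ g '' C := Set.inter_eq_right.1 h2
    exact (Set.eq_of_subset_of_ncard_le h3 hgc.le (Set.toFinite _)).symm
  have hCeq : C = H := by
    refine Set.Subset.antisymm hCH fun p hp => ?_
    by_cases hpD : p ∈ D
    · exact hDC hpD
    obtain ⟨g, hg, h1, h2⟩ := hDJ z p hzD hpD
    rw [← key p hp hpD g hg h1 h2]
    exact ⟨z, hzC, h2⟩
  by_cases hp : ∃ p ∈ H, p ∉ D ∧ p ≠ z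
  · obtain ⟨p, hpH, hpD, hpz⟩ := hp
    obtain ⟨g, hg, h1, h2⟩ := hDJ z p hzD hpD
    have h3 := key p hpH hpD g hg h1 h2
    rw [hCeq] at h3
    refine ⟨g, hg, fun u hu => ?_, x, y, z, hxH, hy, hzH, hsum, ?_⟩
    · have : g u ∈ g '' H := ⟨u, hu, rfl⟩
      rw [h3] at this
      exact this
    · rw [h1 x hxD, h1 y hyD, h2, ← hsum]
      exact fun h => hpz (add_left_cancel h)
  · push Not at hp
    have hDeq : ∀ u, u ∈ D ↔ u ∈ H ∧ u ≠ z := fun u =>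
      ⟨fun h => ⟨hDH h, fun h' => hzD (h' ▸ h)⟩, fun h => by
        by_contra h'
        exact h.2 (hp u h.1 h')⟩
    obtain ⟨v, hvH, hv⟩ : ∃ v ∈ H, v ∉ ({x, y, z} : Set V) := by
      by_contra! h
      have h0 := Set.ncard_le_ncard (s := H) (t := {x, y, z}) h (Set.toFinite _)
      have h1 := Set.ncard_insert_le x {y, z}
      have h2 := Set.ncard_insert_le y {z}
      rw [Set.ncard_singleton] at h2
      omega
    simp only [Set.mem_insert_iff, Set.mem_singleton_iff, not_or] at hv
    obtain ⟨hvx, hvy, hvz⟩ := hv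
    let D2 : Set V := (Equiv.addRight (v - z)) '' D
    have hD2 : ∀ u, u ∈ D2 ↔ u ∈ H ∧ u ≠ v := by
      intro u
      have hvφ : φ v = 0 := hvH
      constructor
      · rintro ⟨d, hd, rfl⟩
        have hd' := (hDeq d).1 hd
        have : φ d = 0 := hd'.1
        refine ⟨?_, ?_⟩
        · simp [H, this, hvφ, hzH]
        · simp only [Equiv.coe_addRight]
          intro h
          apply hd'.2
          rw [← sub_eq_zero]
          calc d - z = (d + (v - z)) - v := by abel
            _ = 0 := by rw [h, sub_self]
      · rintro ⟨hu, huv⟩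
        have hu' : φ u = 0 := hu
        refine ⟨u - (v - z), (hDeq _).2 ⟨by simp [H, hu', hvφ, hzH], fun h => huv ?_⟩, by simp⟩
        rw [← sub_eq_zero]
        calc u - v = u - (v - z) - z := by abel
          _ = 0 := by rw [h, sub_self]
    have hD2J : Jor G D2 := hDJ.image (hG (trans_mem _))
    have hD3J : Jor G (D ∩ D2) := hcap _ _ hDJ hD2J (hsub _ hDH)
      (hsub _ fun u hu => ((hD2 u).1 hu).1)
    obtain ⟨a, ha, a1, a2⟩ := hD3J z v (fun h => hzD h.1) (fun h => ((hD2 v).1 h.2).2 rfl)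
    have hD3 : ∀ u ∈ H, u ≠ z → u ≠ v → u ∈ D ∩ D2 := fun u hu h1 h2 =>
      ⟨(hDeq u).2 ⟨hu, h1⟩, (hD2 u).2 ⟨hu, h2⟩⟩
    have hav : a v ∉ D := by
      intro h
      by_cases h' : a v = v
      · exact hvz (a.injective (h'.trans a2.symm))
      · have h2 := (hDeq _).1 h
        have h3 := a1 _ (hD3 _ h2.1 h2.2 h')
        exact h' (a.injective h3)
    obtain ⟨b, hb, b1, b2⟩ := hDJ (a v) z hav hzD
    have hvD : v ∈ D := (hDeq v).2 ⟨hvH, hvz⟩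
    have fixed : ∀ u ∈ H, u ≠ z → u ≠ v → (b * a) u = u := fun u hu h1 h2 => by
      rw [Perm.mul_apply, a1 u (hD3 u hu h1 h2), b1 u ((hDeq u).2 ⟨hu, h1⟩)]
    have hzv : (b * a) z = v := by rw [Perm.mul_apply, a2, b1 v hvD]
    have hvz' : (b * a) v = z := by rw [Perm.mul_apply, b2]
    refine ⟨b * a, mul_mem hb ha, fun u hu => ?_, x, y, z, hxH, hy, hzH, hsum, ?_⟩
    · by_cases h1 : u = z
      · rw [h1, hzv]; exact hvH
      · by_cases h2 : u = v
        · rw [h2, hvz']; exact hzH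
        · rw [fixed u hu h1 h2]; exact hu
    · rw [fixed x hxH hxz (Ne.symm hvx), fixed y hy hyz (Ne.symm hvy), hzv, ← hsum]
      exact fun h => hvz (add_left_cancel h)

end jordan

theorem norm_dich {Γ : Type} [Group Γ] [Finite Γ] (N U : Subgroup Γ) [N.Normal] (hUN : U ≤ N)
    (hU : IsPGroup 3 U) :
    (∃ g ∈ N, g ∉ U ∧ (∃ k, g ^ (3 ^ k) = 1) ∧ ∀ u ∈ U, g * u * g⁻¹ ∈ U) ∨
      ∀ a : Γ, ∃ r ∈ N, ∀ u ∈ U, (a * r) * u * (a * r)⁻¹ ∈ U := by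
  have : Fact (Nat.Prime 3) := ⟨Nat.prime_three⟩
  have hU' : IsPGroup 3 (U.subgroupOf N) := hU.of_equiv (Subgroup.subgroupOfEquivOfLe hUN).symm
  obtain ⟨P, hP⟩ := hU'.exists_le_sylow
  by_cases h : U.subgroupOf N = P
  · right
    intro a
    have hF := Sylow.normalizer_sup_eq_top P
    rw [← h, Subgroup.subgroupOf_map_subtype, inf_of_le_left hUN] at hF
    have ha : a ∈ Subgroup.normalizer (U : Set Γ) ⊔ N := by rw [hF]; trivial
    obtain ⟨y, hy, z, hz, rfl⟩ := Subgroup.mem_sup_of_normal_right.1 ha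
    refine ⟨z⁻¹, inv_mem hz, fun u hu => ?_⟩
    rw [mul_inv_cancel_right]
    exact (Subgroup.mem_normalizer_iff.1 hy u).1 hu
  · left
    have hn : Group.IsNilpotent P := P.isPGroup'.isNilpotent
    have hc := Group.normalizerCondition_of_isNilpotent (G := P) ((U.subgroupOf N).subgroupOf P) (by
      rw [lt_top_iff_ne_top]
      intro h'
      rw [Subgroup.subgroupOf_eq_top] at h'
      exact h (le_antisymm hP h'))
    obtain ⟨g, hg, hgU⟩ := SetLike.exists_of_lt hc
    refine ⟨g.1.1, g.1.2, fun h' => hgU h', ?_, fun u hu => ?_⟩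
    · obtain ⟨k, hk⟩ := P.isPGroup' g
      refine ⟨k, ?_⟩
      have := congrArg (fun x : P => (x : Γ)) hk
      simpa using this
    · exact (Subgroup.mem_normalizer_iff.1 hg ⟨⟨u, hUN hu⟩, hP hu⟩).1 hu

section ind
variable {V : Type} [AddCommGroup V] [Module (ZMod 3) V] [Finite V]

theorem z3 (a : ZMod 3) : a = 0 ∨ a = 1 ∨ a = -1 := by revert a; decide

/-- stabilizer of the hyperplane -/
def stabA (G : Subgroup (Perm V)) (φ : V →ₗ[ZMod 3] ZMod 3) : Subgroup (Perm V) where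
  carrier := {g | g ∈ G ∧ ∀ x, φ (g x) = 0 ↔ φ x = 0}
  one_mem' := ⟨one_mem _, fun x => Iff.rfl⟩
  mul_mem' := fun {a b} ha hb => ⟨mul_mem ha.1 hb.1, fun x => (ha.2 _).trans (hb.2 _)⟩
  inv_mem' := fun {a} ha => ⟨inv_mem ha.1, fun x => by rw [← ha.2]; simp⟩

/-- pointwise stabilizer of the hyperplane -/
def fixN (G : Subgroup (Perm V)) (φ : V →ₗ[ZMod 3] ZMod 3) : Subgroup (stabA G φ) where
  carrier := {g | ∀ x, φ x = 0 → g.1 x = x}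
  one_mem' := fun x _ => rfl
  mul_mem' := fun {a b} ha hb x hx => by
    show a.1 (b.1 x) = x
    rw [hb x hx, ha x hx]
  inv_mem' := fun {a} ha x hx => by
    show a.1⁻¹ x = x
    rw [Perm.inv_eq_iff_eq, ha x hx]

instance (G : Subgroup (Perm V)) (φ : V →ₗ[ZMod 3] ZMod 3) : (fixN G φ).Normal where
  conj_mem := fun n hn g x hx => by
    show g.1 (n.1 (g.1⁻¹ x)) = x
    have : φ (g.1⁻¹ x) = 0 := by rw [← g.2.2]; simpa using hx
    rw [hn _ this]
    simp

/-- transvections -/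
def tvU (G : Subgroup (Perm V)) (φ : V →ₗ[ZMod 3] ZMod 3) : Subgroup (stabA G φ) where
  carrier := {g | ∃ u, φ u = 0 ∧ ∀ x, g.1 x = x + φ x • u}
  one_mem' := ⟨0, by simp, fun x => by simp⟩
  mul_mem' := by
    rintro a b ⟨u, hu, ha⟩ ⟨v, hv, hb⟩
    refine ⟨u + v, by simp [hu, hv], fun x => ?_⟩
    show a.1 (b.1 x) = _
    rw [ha, hb]
    simp only [map_add, map_smul, hv, smul_zero, add_zero, smul_add]
    abel
  inv_mem' := by
    rintro a ⟨u, hu, ha⟩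
    refine ⟨-u, by simp [hu], fun x => ?_⟩
    show a.1⁻¹ x = _
    rw [Perm.inv_eq_iff_eq, ha]
    simp [hu]

theorem tv_le (G : Subgroup (Perm V)) (φ : V →ₗ[ZMod 3] ZMod 3) : tvU G φ ≤ fixN G φ := by
  rintro a ⟨u, hu, ha⟩ x hx
  rw [ha, hx]; simp

theorem tv_p (G : Subgroup (Perm V)) (φ : V →ₗ[ZMod 3] ZMod 3) : IsPGroup 3 (tvU G φ) := by
  rintro ⟨a, u, hu, ha⟩
  refine ⟨1, ?_⟩
  apply Subtype.ext
  apply Subtype.ext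
  ext x
  show (a.1 ^ (3 ^ 1)) x = x
  rw [pow_one, pow_succ, pow_two]
  simp only [Perm.mul_apply, ha]
  have := tri (φ x • u)
  simp [hu, add_assoc] at this ⊢
  exact this

/-- step 2 -/
theorem exists_norm {G : Subgroup (Perm V)} (hG : Aff V ≤ G) {g : Perm V} (hg : g ∈ G)
    (φ : V →ₗ[ZMod 3] ZMod 3) (w : V) (hw : φ w = 1)
    (h1 : ∀ x, φ x = 0 → φ (g x) = 0)
    (h2 : ∃ x y z, φ x = 0 ∧ φ y = 0 ∧ φ z = 0 ∧ x + y + z = 0 ∧ g x + g y + g z ≠ 0) :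
    ∃ g ∈ stabA G φ, g ∉ Aff V ∧ ∀ u, φ u = 0 → ∃ u', φ u' = 0 ∧
      ∀ x, g (x + φ x • u) = g x + φ (g x) • u' := by
  have conv : ∀ g : stabA G φ, (∀ u ∈ tvU G φ, g * u * g⁻¹ ∈ tvU G φ) → 
      ∀ u, φ u = 0 → ∃ u', φ u' = 0 ∧ ∀ x, g.1 (x + φ x • u) = g.1 x + φ (g.1 x) • u' := by
    intro g hg u hu
    obtain ⟨f, hf, hfx⟩ := exists_shear φ u (by simp [hu])
    obtain ⟨u', hu', h⟩ := hg ⟨f, hG hf, fun x => by rw [hfx]; simp [hu]⟩ ⟨u, hu, hfx⟩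
    refine ⟨u', hu', fun x => ?_⟩
    rw [← h (g.1 x), ← hfx]
    show _ = g.1 (f (g.1⁻¹ (g.1 x)))
    simp
  have hgA : g ∈ stabA G φ := by
    refine ⟨hg, fun x => ⟨fun h => ?_, h1 x⟩⟩
    have hinj : Function.Injective (fun y : {y // φ y = 0} => (⟨g y.1, h1 _ y.2⟩ : {y // φ y = 0})) :=
      fun a b hab => Subtype.ext (g.injective (congrArg Subtype.val hab))
    obtain ⟨y, hy⟩ := (Finite.injective_iff_surjective.1 hinj) ⟨g x, h⟩
    have := g.injective (congrArg Subtype.val hy)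
    rw [← this]; exact y.2
  rcases norm_dich (fixN G φ) (tvU G φ) (tv_le G φ) (tv_p G φ) with ⟨r, hrN, hrU, ⟨k, hk⟩, hr⟩ | h
  · refine ⟨r.1, r.2, fun hA => ?_, conv r hr⟩
    have hform : ∀ x, r.1 x = x + φ x • (r.1 w - w) := by
      intro x
      have h0 : r.1 0 = 0 := hrN 0 (by simp)
      have hneg : r.1 (-w) = - r.1 w := by
        have := hA w (-w) 0 (by simp)
        rw [h0, add_zero] at this
        exact (neg_eq_of_add_eq_zero_right this).symm
      have hadd : ∀ a b, r.1 (a + b) = r.1 a + r.1 b := by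
        intro a b
        have e1 := hA (a + b) (-(a + b)) 0 (by simp)
        have e2 := hA a b (-(a + b)) (by abel)
        rw [h0, add_zero] at e1
        rw [← sub_eq_zero]
        calc _ = (r.1 (a + b) + r.1 (-(a + b))) - (r.1 a + r.1 b + r.1 (-(a + b))) := by abel
          _ = 0 := by rw [e1, e2, sub_zero]
      have hx : x = (x - φ x • w) + φ x • w := by abel
      have hs : r.1 (φ x • w) = φ x • r.1 w := by
        rcases z3 (φ x) with h | h | h <;> rw [h] <;> simp [h0, hneg]
      conv_lhs => rw [hx]
      rw [hadd, hrN _ (by simp [hw]), hs]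
      module
    rcases z3 (φ (r.1 w - w)) with h | h | h
    · exact hrU ⟨_, h, hform⟩
    · have hneg : ∀ x, φ (r.1 x) = - φ x := by
        intro x
        rw [hform, map_add, map_smul, h, smul_eq_mul]
        generalize φ x = t
        revert t; decide
      have hpow : ∀ j x, φ ((r.1 ^ j) x) = (-1) ^ j * φ x := by
        intro j
        induction j with
        | zero => simp
        | succ j ih => intro x; rw [pow_succ', Perm.mul_apply, hneg, ih]; ring
      have h3 := hpow (3 ^ k) w
      have h4 : r.1 ^ (3 ^ k) = 1 := congrArg Subtype.val hk
      rw [h4, Odd.neg_one_pow (Odd.pow (by decide)), Perm.one_apply, hw] at h3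
      exact absurd h3 (by decide)
    · have : φ (r.1 w) = 0 := by
        rw [map_sub, hw] at h
        linear_combination h
      rw [r.2.2, hw] at this
      exact one_ne_zero this
  · obtain ⟨r, hr, hn⟩ := h ⟨g, hgA⟩
    refine ⟨g * r.1, mul_mem hgA r.2, fun hA => ?_, conv (⟨g, hgA⟩ * r) hn⟩
    obtain ⟨x, y, z, hx, hy, hz, hs, hne⟩ := h2
    apply hne
    have := hA x y z hs
    rwa [Perm.mul_apply, Perm.mul_apply, Perm.mul_apply, hr x hx, hr y hy, hr z hz] at this

end ind

section ind2
variable {V : Type} [AddCommGroup V] [Module (ZMod 3) V] [Finite V]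

/-- step 3 -/
theorem exists_supp {G : Subgroup (Perm V)} (hG : Aff V ≤ G) {g : Perm V}
    (φ : V →ₗ[ZMod 3] ZMod 3) (w : V) (hw : φ w = 1) (hg : g ∈ stabA G φ) (hgA : g ∉ Aff V)
    (hn : ∀ u, φ u = 0 → ∃ u', φ u' = 0 ∧ ∀ x, g (x + φ x • u) = g x + φ (g x) • u') :
    ∃ π ∈ G, π ≠ 1 ∧ ∀ x, φ x ≠ 0 → π x = x := by
  choose! m hm0 hm using hn
  obtain ⟨ε, hε⟩ : ∃ ε, φ (g w) = ε := ⟨_, rfl⟩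
  have hε0 : ε ≠ 0 := by rw [← hε, Ne, hg.2, hw]; exact one_ne_zero
  have hp : ∀ u, φ u = 0 → g (w + u) = g w + ε • m u := fun u hu => by
    have := hm u hu w
    rwa [hw, one_smul, hε] at this
  have hmadd : ∀ u v, φ u = 0 → φ v = 0 → m (u + v) = m u + m v := by
    intro u v hu hv
    have h1 := hp (u + v) (by simp [hu, hv])
    have h2 := hm v hv (w + u)
    rw [map_add φ, hw, hu, add_zero, one_smul, hp u hu, map_add φ, map_smul, hm0 u hu, smul_zero,
      add_zero, hε, add_assoc, h1, add_assoc, ← smul_add] at h2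
    exact smul_right_injective _ hε0 (add_left_cancel h2)
  have hm00 : m 0 = 0 := by
    have := hmadd 0 0 (by simp) (by simp)
    simpa using this
  have hmneg : ∀ u, φ u = 0 → m (-u) = - m u := fun u hu => by
    have := hmadd u (-u) hu (by simp [hu])
    rw [add_neg_cancel, hm00] at this
    exact (neg_eq_of_add_eq_zero_right this.symm).symm
  have hq : ∀ u, φ u = 0 → g (-w + u) = g (-w) - φ (g (-w)) • m u := fun u hu => by
    have := hm (-u) (by simp [hu]) (-w)
    rw [map_neg, hw, hmneg u hu] at this
    simpa [sub_eq_add_neg] using this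
  have hδ : φ (g (-w)) = -ε := by
    obtain ⟨x, hx⟩ := g.surjective (- g w)
    have h1 : φ (g x) = -ε := by rw [hx, map_neg, hε]
    rcases z3 (φ x) with h | h | h
    · rw [(hg.2 x).2 h] at h1
      exact absurd (neg_eq_zero.1 h1.symm) hε0
    · have h2 := hp (x - w) (by rw [map_sub, h, hw, sub_self])
      rw [add_sub_cancel] at h2
      rw [h2, map_add, hε, map_smul, hm0 _ (by rw [map_sub, h, hw, sub_self])] at h1
      exfalso
      clear hp hε
      revert h1 hε0
      generalize ε = e
      clear * -
      revert e
      decide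
    · have h0 : φ (x + w) = 0 := by rw [map_add, h, hw]; simp
      have h2 := hq (x + w) h0
      rw [neg_add_cancel_comm_assoc] at h2
      rw [h2, map_sub, map_smul, hm0 _ h0, smul_zero, sub_zero] at h1
      exact h1
  obtain ⟨c0, hc0⟩ : ∃ c, c = -(g w + g (-w)) := ⟨_, rfl⟩
  have hφc : φ c0 = 0 := by rw [hc0, map_neg, map_add, hε, hδ]; simp
  have hgm : g (-w) = - c0 - g w := by rw [hc0]; abel
  let α0 : V → V := fun x => ε • m (x - φ x • w) + (c0 + φ x • (g w - c0))
  have hk : ∀ x, φ (x - φ x • w) = 0 := fun x => by simp [hw]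
  have hφα : ∀ x, φ (α0 x) = φ x * ε := fun x => by
    simp [α0, hm0 _ (hk x), hφc, hε]
  have hinj : Function.Injective α0 := by
    intro x y hxy
    have h1 := congrArg φ hxy
    rw [hφα, hφα] at h1
    have h2 : φ x = φ y := mul_right_cancel₀ hε0 h1
    simp only [α0, ← h2] at hxy
    have h3 := add_right_cancel hxy
    have h4 := hp _ (hk x)
    have h5 := hp (y - φ x • w) (by rw [h2]; exact hk y)
    rw [h3, ← h5] at h4
    exact sub_left_injective (add_left_cancel (g.injective h4))
  let α : Perm V := Equiv.ofBijective α0 (Finite.injective_iff_bijective.1 hinj)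
  have hα : ∀ x, α x = ε • m (x - φ x • w) + (c0 + φ x • (g w - c0)) := fun x => rfl
  have hαA : α ∈ Aff V := by
    intro x y z h
    have e1 : φ x + φ y + φ z = 0 := by rw [← map_add, ← map_add, h, map_zero]
    have e2 : m (x - φ x • w) + m (y - φ y • w) + m (z - φ z • w) = 0 := by
      rw [← hmadd _ _ (hk x) (hk y), ← hmadd _ _ (by rw [map_add, hk, hk, add_zero]) (hk z), ← hm00]
      congr 1
      calc _ = (x + y + z) - (φ x + φ y + φ z) • w := by module
        _ = 0 := by rw [h, e1]; simp
    rw [hα, hα, hα]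
    calc _ = ε • (m (x - φ x • w) + m (y - φ y • w) + m (z - φ z • w)) + (c0 + c0 + c0) +
          (φ x + φ y + φ z) • (g w - c0) := by module
      _ = 0 := by rw [e1, e2, tri]; simp
  have hagree : ∀ x, φ x ≠ 0 → α x = g x := by
    intro x hx
    rcases z3 (φ x) with h | h | h
    · exact absurd h hx
    · have h2 := hp _ (hk x)
      rw [hα]
      rw [h, one_smul] at h2 ⊢
      rw [add_sub_cancel] at h2
      rw [h2, one_smul]
      abel
    · have h2 := hq _ (hk x)
      rw [hα]
      rw [h, hδ, hgm] at h2
      rw [h]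
      have e : -w + (x - (-1 : ZMod 3) • w) = x := by module
      rw [e] at h2
      rw [h2]
      have := tri c0
      rw [← sub_eq_zero, ← this]
      module
  refine ⟨α⁻¹ * g, mul_mem (inv_mem (hG hαA)) hg.1, fun h => hgA ?_, fun x hx => ?_⟩
  · have : g = α := (inv_mul_eq_one.1 h).symm
    rw [this]; exact hαA
  · rw [Perm.mul_apply, Perm.inv_eq_iff_eq, hagree x hx]

/-- permutations of the hyperplane induced by `G` -/
def Qs (G : Subgroup (Perm V)) (φ : V →ₗ[ZMod 3] ZMod 3) : Subgroup (Perm (LinearMap.ker φ)) where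
  carrier := {σ | ∃ g ∈ G, ∀ h : LinearMap.ker φ, g h.1 = (σ h).1}
  one_mem' := ⟨1, one_mem _, fun h => rfl⟩
  mul_mem' := by
    rintro a b ⟨g, hg, h1⟩ ⟨k, hk, h2⟩
    exact ⟨g * k, mul_mem hg hk, fun h => by rw [Perm.mul_apply, h2, h1]; rfl⟩
  inv_mem' := by
    rintro a ⟨g, hg, h1⟩
    exact ⟨g⁻¹, inv_mem hg, fun h => by rw [Perm.inv_eq_iff_eq, h1]; simp⟩

theorem aff_le_Qs {G : Subgroup (Perm V)} (hG : Aff V ≤ G) (φ : V →ₗ[ZMod 3] ZMod 3) (w : V)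
    (hw : φ w = 1) : Aff (LinearMap.ker φ) ≤ Qs G φ := by
  intro σ hσ
  let E := splitE φ w hw
  let s : Perm V := E.permCongr (Equiv.prodCongr σ (Equiv.refl _))
  have hs : ∀ x, s x = (σ ⟨x - φ x • w, by simp [hw]⟩).1 + φ x • w := fun x => rfl
  refine ⟨s, hG ?_, ?_⟩
  · intro x y z h
    have e1 : φ x + φ y + φ z = 0 := by rw [← map_add, ← map_add, h, map_zero]
    have e2 := hσ ⟨x - φ x • w, by simp [hw]⟩ ⟨y - φ y • w, by simp [hw]⟩ ⟨z - φ z • w, by simp [hw]⟩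
      (by
        apply Subtype.ext
        show (x - φ x • w) + (y - φ y • w) + (z - φ z • w) = 0
        calc _ = (x + y + z) - (φ x + φ y + φ z) • w := by module
          _ = 0 := by rw [h, e1]; simp)
    have e3 := congrArg Subtype.val e2
    simp only [Submodule.coe_add, Submodule.coe_zero] at e3
    rw [hs, hs, hs]
    calc _ = ((σ ⟨x - φ x • w, by simp [hw]⟩).1 + (σ ⟨y - φ y • w, by simp [hw]⟩).1 +
        (σ ⟨z - φ z • w, by simp [hw]⟩).1) + (φ x + φ y + φ z) • w := by module
      _ = 0 := by rw [e3, e1]; simp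
  · rintro ⟨h, hh⟩
    have hh' : φ h = 0 := hh
    rw [hs]
    simp [hh']

theorem step {G : Subgroup (Perm V)} (hG : Aff V ≤ G) {g : Perm V} (hg : g ∈ G)
    (hgA : g ∉ Aff V) (φ : V →ₗ[ZMod 3] ZMod 3) (w : V) (hw : φ w = 1)
    (hK : 9 ≤ Nat.card (LinearMap.ker φ))
    (ih : ∀ (Q : Subgroup (Perm (LinearMap.ker φ))), Aff (LinearMap.ker φ) ≤ Q →
      ∀ σ ∈ Q, σ ∉ Aff (LinearMap.ker φ) → Q = ⊤) : G = ⊤ := by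
  classical
  have : Fintype V := Fintype.ofFinite V
  have : Nontrivial V := ⟨⟨w, 0, fun h => by rw [h, map_zero] at hw; exact zero_ne_one hw⟩⟩
  obtain ⟨a, haG, ha1, ha2⟩ := exists_stab hG hg hgA φ w hw hK
  have hQ : Qs G φ = ⊤ := by
    have hinj : Function.Injective
        (fun y : LinearMap.ker φ => (⟨a y.1, ha1 _ y.2⟩ : LinearMap.ker φ)) :=
      fun p q h => Subtype.ext (a.injective (congrArg Subtype.val h))
    refine ih _ (aff_le_Qs hG φ w hw)
      (Equiv.ofBijective _ (Finite.injective_iff_bijective.1 hinj)) ⟨a, haG, fun h => rfl⟩ ?_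
    intro hA
    obtain ⟨x, y, z, hx, hy, hz, hs, hne⟩ := ha2
    exact hne (congrArg Subtype.val (hA ⟨x, hx⟩ ⟨y, hy⟩ ⟨z, hz⟩ (Subtype.ext hs)))
  obtain ⟨b, hb, hbA, hbn⟩ := exists_norm hG haG φ w hw ha1 ha2
  obtain ⟨π, hπ, hπ1, hπf⟩ := exists_supp hG φ w hw hb hbA hbn
  let M : Subgroup (Perm (LinearMap.ker φ)) :=
    G.comap (Perm.ofSubtype (p := fun x => x ∈ LinearMap.ker φ))
  have hM : M.Normal := ⟨by
    intro σ hσ τ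
    have hτ : τ ∈ Qs G φ := by rw [hQ]; trivial
    obtain ⟨t, ht, htτ⟩ := hτ
    have : Perm.ofSubtype (p := fun x => x ∈ LinearMap.ker φ) (τ * σ * τ⁻¹) =
        t * Perm.ofSubtype (p := fun x => x ∈ LinearMap.ker φ) σ * t⁻¹ := by
      ext x
      obtain ⟨x, rfl⟩ := t.surjective x
      simp only [Perm.mul_apply]
      rw [show t⁻¹ (t x) = x from t.symm_apply_apply x]
      by_cases hx : x ∈ LinearMap.ker φ
      · have e1 := htτ ⟨x, hx⟩
        simp only at e1
        rw [e1, Perm.ofSubtype_apply_coe, Perm.ofSubtype_apply_of_mem σ hx, htτ]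
        simp
      · rw [Perm.ofSubtype_apply_of_not_mem σ hx, Perm.ofSubtype_apply_of_not_mem]
        intro h
        apply hx
        have e1 := htτ (τ⁻¹ ⟨t x, h⟩)
        simp only [show ∀ y, τ (τ⁻¹ y) = y from fun y => τ.apply_symm_apply y] at e1
        rw [← t.injective e1]
        exact Subtype.property _
    show Perm.ofSubtype _ ∈ G
    rw [this]
    exact mul_mem (mul_mem ht hσ) (inv_mem ht)⟩
  have hMn : Nontrivial M := by
    have hpres : ∀ x, π x ∈ LinearMap.ker φ ↔ x ∈ LinearMap.ker φ := by
      intro x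
      constructor
      · intro h
        by_contra h'
        rw [hπf x h'] at h
        exact h' h
      · intro h
        by_contra h'
        have := π.injective (hπf _ h')
        rw [this] at h'
        exact h' h
    have e : Perm.ofSubtype (Perm.subtypePerm π hpres) = π :=
      Perm.ofSubtype_subtypePerm hpres (fun x hx => by
        by_contra h
        exact hx (hπf x h))
    rw [Subgroup.nontrivial_iff_exists_ne_one]
    refine ⟨Perm.subtypePerm π hpres, ?_, fun h => hπ1 ?_⟩
    · show Perm.ofSubtype _ ∈ G
      rw [e]; exact hπ
    · rw [← e, h, map_one]
  have hAlt := Perm.alternatingGroup_le_of_normal (N := M) (by omega) hMn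
  have hcard : 2 < Fintype.card (LinearMap.ker φ) := by
    rw [← Nat.card_eq_fintype_card]; omega
  obtain ⟨p, q, r, hpq, hpr, hqr⟩ := Fintype.two_lt_card_iff.1 hcard
  have h3 := Perm.isThreeCycle_swap_mul_swap_same hpq hpr hqr
  refine finish hG (hAlt h3.mem_alternatingGroup) ?_
  rw [Perm.IsThreeCycle, Perm.cycleType_ofSubtype]
  exact h3

end ind2

theorem main_gen (d : ℕ) : ∀ (V : Type) [AddCommGroup V] [Module (ZMod 3) V] [Finite V],
    Module.finrank (ZMod 3) V = d + 2 → ∀ G : Subgroup (Perm V), Aff V ≤ G →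
      ∀ g ∈ G, g ∉ Aff V → G = ⊤ := by
  induction d with
  | zero =>
    intro V _ _ _ h G hG g hg hgA
    exact base_gen h hG hg hgA
  | succ d ih =>
    intro V _ _ _ h G hG g hg hgA
    have : Nontrivial V := Module.nontrivial_of_finrank_pos (R := ZMod 3) (by omega)
    obtain ⟨v, hv⟩ := exists_ne (0 : V)
    obtain ⟨φ, hφ, -⟩ := Submodule.exists_le_ker_of_notMem (K := ZMod 3)
      (p := (⊥ : Submodule (ZMod 3) V)) (v := v) (by simpa)
    obtain ⟨w, hw⟩ : ∃ w, φ w = 1 := ⟨(φ v)⁻¹ • v, by simp [hφ]⟩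
    have hsurj : Function.Surjective φ := fun t => ⟨t • w, by simp [hw]⟩
    have hr := LinearMap.finrank_range_add_finrank_ker φ
    rw [LinearMap.range_eq_top.2 hsurj, finrank_top, Module.finrank_self, h] at hr
    have hk : Module.finrank (ZMod 3) (LinearMap.ker φ) = d + 2 := by omega
    have hc : Nat.card (LinearMap.ker φ) = 3 ^ (d + 2) := by
      rw [Module.natCard_eq_pow_finrank (K := ZMod 3), hk, Nat.card_zmod]
    refine step hG hg hgA φ w hw ?_ (fun Q hQ σ hσ hσA => ih _ hk Q hQ σ hσ hσA)
    rw [hc, pow_add]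
    have : 0 < 3 ^ d := by positivity
    omega

theorem Aff_eq (n : ℕ) : Aff (Fin n → ZMod 3) = affineSubgroup n := by
  ext f
  constructor
  · intro hf
    let L0 : (Fin n → ZMod 3) →+ (Fin n → ZMod 3) := AddMonoidHom.mk' (fun x => f x - f 0) (by
      intro a b
      have e1 := hf (a + b) (-(a + b)) 0 (by simp)
      have e2 := hf a b (-(a + b)) (by abel)
      have e3 := tri (f 0)
      rw [← sub_eq_zero]
      calc _ = (f (a + b) + f (-(a + b)) + f 0) - (f a + f b + f (-(a + b))) := by abel
        _ = 0 := by rw [e1, e2, sub_zero])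
    let L : (Fin n → ZMod 3) →ₗ[ZMod 3] (Fin n → ZMod 3) := AddMonoidHom.toZModLinearMap 3 L0
    have hL : ∀ x, L x = f x - f 0 := fun x => rfl
    have hinj : Function.Injective L := fun x y h => by
      rw [hL, hL] at h
      exact f.injective (sub_left_injective h)
    let e := LinearEquiv.ofInjectiveEndo L hinj
    let A : GL (Fin n) (ZMod 3) := Matrix.GeneralLinearGroup.mkOfDetNeZero (LinearMap.toMatrix' L) (by
      rw [LinearMap.det_toMatrix']
      exact (LinearEquiv.isUnit_det' e).ne_zero)
    refine ⟨A, f 0, fun x => ?_⟩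
    show f x = (LinearMap.toMatrix' L).mulVec x + f 0
    rw [LinearMap.toMatrix'_mulVec, hL, sub_add_cancel]
  · rintro ⟨A, v, h⟩ x y z hs
    rw [h, h, h]
    calc _ = (A : Matrix (Fin n) (Fin n) (ZMod 3)).mulVec (x + y + z) + (v + v + v) := by
          rw [Matrix.mulVec_add, Matrix.mulVec_add]; abel
      _ = 0 := by rw [hs, tri]; simp

/-- For every `n ≥ 2`, the group of affine permutations of `F₃ⁿ` is a maximal
proper subgroup of the full symmetric group on `F₃ⁿ`. -/
theorem affineSubgroup_isMaximal (n : ℕ) (hn : 2 ≤ n) : IsCoatom (affineSubgroup n) := by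
  rw [← Aff_eq]
  constructor
  · intro htop
    let i : Fin n := ⟨0, by omega⟩
    let j : Fin n := ⟨1, by omega⟩
    have hij : i ≠ j := by simp [i, j]
    let p : Fin n → ZMod 3 := Pi.single i 1
    let q : Fin n → ZMod 3 := Pi.single j 1
    have hp0 : p ≠ 0 := by simp [p]
    have hq0 : q ≠ 0 := by simp [q]
    have hpq : p ≠ q := fun h => by
      have := congrFun h i
      simp [p, q, Pi.single_eq_of_ne hij] at this
    have hnq : -p ≠ q := fun h => by
      have := congrFun h i
      simp [p, q, Pi.single_eq_of_ne hij] at this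
    have hnp : -p ≠ p := fun h => by
      have := congrFun h i
      simp [p] at this
      exact absurd this (by decide)
    have hm : Equiv.swap p q ∈ Aff (Fin n → ZMod 3) := by rw [htop]; trivial
    have h := hm p (-p) 0 (by simp)
    rw [Equiv.swap_apply_left, Equiv.swap_apply_of_ne_of_ne hnp hnq,
      Equiv.swap_apply_of_ne_of_ne hp0.symm hq0.symm, add_zero, add_neg_eq_zero] at h
    exact hpq h.symm
  · intro G hlt
    obtain ⟨g, hg, hgA⟩ := SetLike.exists_of_lt hlt
    refine main_gen (n - 2) _ ?_ G hlt.le g hg hgA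
    rw [Module.finrank_fin_fun]
    omega
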